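/- Let A be an n×n complex matrix, λ₀ an eigenvalue of A, and r the geometric multiplicity of λ₀, i.e. r = dim ker(A − λ₀I). Let B(ε) be an n×n-matrix-valued function given by a power series B(ε) = Σ_{k≥1} B_k ε^k convergent for |ε| small (so B(0) = 0). Then det(A + B(ε) − λ₀I) = O(ε^r) as ε → 0. -/

import Mathlib

open Matrix

attribute [local instance] Matrix.normedAddCommGroup Matrix.normedSpace

/-- If `λ₀` is an eigenvalue of `A` of geometric multiplicity `r`, and
`B(ε)` is an analytic matrix-valued perturbation with `B(0) = 0`, then
`det(A + B(ε) − λ₀I) = O(ε^r)` as `ε → 0`. -/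
theorem det_perturbation_geometric_multiplicity (n : ℕ)
    (A : Matrix (Fin n) (Fin n) ℂ) (lam₀ : ℂ)
    (heig : (A - lam₀ • (1 : Matrix (Fin n) (Fin n) ℂ)).det = 0)
    (r : ℕ)
    (hr : r = Module.finrank ℂ
      (LinearMap.ker (A - lam₀ • (1 : Matrix (Fin n) (Fin n) ℂ)).mulVecLin))
    (B : ℂ → Matrix (Fin n) (Fin n) ℂ) (hB : AnalyticAt ℂ B 0) (hB0 : B 0 = 0) :
    (fun ε : ℂ => (A + B ε - lam₀ • (1 : Matrix (Fin n) (Fin n) ℂ)).det)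
      =O[nhds 0] (fun ε => ε ^ r) := by
  classical
  set M := A - lam₀ • (1 : Matrix (Fin n) (Fin n) ℂ) with hM
  set K := LinearMap.ker M.mulVecLin with hK
  obtain ⟨C, hC⟩ := Submodule.exists_isCompl K
  let b : Module.Basis (Fin (Module.finrank ℂ K) ⊕ Fin (Module.finrank ℂ C)) ℂ (Fin n → ℂ) :=
    ((Module.finBasis ℂ K).prod (Module.finBasis ℂ C)).map (Submodule.prodEquivOfIsCompl K C hC)
  have hbK : ∀ j, M *ᵥ (b (Sum.inl j)) = 0 := by
    intro j
    have h1 : b (Sum.inl j) = (Module.finBasis ℂ K j : Fin n → ℂ) := by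
      simp [b]
    rw [h1]
    exact (Module.finBasis ℂ K j).2
  let φ : ∀ _ _ : (Fin (Module.finrank ℂ K) ⊕ Fin (Module.finrank ℂ C)),
      Matrix (Fin n) (Fin n) ℂ →ₗ[ℂ] ℂ := fun i j =>
    (b.coord i) ∘ₗ (LinearMap.applyₗ (b j)) ∘ₗ
      (Matrix.toLin' : Matrix (Fin n) (Fin n) ℂ ≃ₗ[ℂ] _).toLinearMap
  have hφ : ∀ i j X, φ i j X = b.repr (X *ᵥ b j) i := by
    intro i j X
    simp [φ]
  have hBO : B =O[nhds 0] (fun ε : ℂ => ε) := by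
    have := hB.differentiableAt.isBigO_sub
    simpa [hB0] using this
  have hφB : ∀ i j, (fun ε => φ i j (B ε)) =O[nhds 0] (fun ε : ℂ => ε) := by
    intro i j
    exact ((LinearMap.toContinuousLinearMap (φ i j)).isBigO_comp B (nhds 0)).trans hBO
  have hid : (fun ε : ℂ => ε) =O[nhds 0] (fun _ : ℂ => (1 : ℂ)) :=
    (continuous_id.tendsto (0 : ℂ)).isBigO_one ℂ
  have hdet : ∀ ε, (A + B ε - lam₀ • (1 : Matrix (Fin n) (Fin n) ℂ)).det
      = (Matrix.of fun i j => φ i j M + φ i j (B ε)).det := by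
    intro ε
    have h1 : A + B ε - lam₀ • (1 : Matrix (Fin n) (Fin n) ℂ) = M + B ε := by
      rw [hM]; abel
    rw [h1, ← LinearMap.det_toLin', ← LinearMap.det_toMatrix b]
    congr 1
    ext i j
    rw [LinearMap.toMatrix_apply, Matrix.of_apply, ← map_add, hφ, Matrix.toLin'_apply]
  simp_rw [hdet, Matrix.det_apply]
  apply Asymptotics.IsBigO.fun_sum; intro σ _
  have key : (fun ε : ℂ => ∏ j, (φ (σ j) j M + φ (σ j) j (B ε))) =O[nhds 0]
      (fun ε : ℂ => ∏ j : (Fin (Module.finrank ℂ K) ⊕ Fin (Module.finrank ℂ C)),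
        Sum.elim (fun _ => ε) (fun _ => (1 : ℂ)) j) := by
    refine Asymptotics.IsBigO.finsetProd fun j _ => ?_
    rcases j with j | j
    · have h0 : φ (σ (Sum.inl j)) (Sum.inl j) M = 0 := by
        rw [hφ, hbK]; simp
      simpa [h0] using hφB (σ (Sum.inl j)) (Sum.inl j)
    · exact (Asymptotics.isBigO_const_const _ one_ne_zero _).add ((hφB _ _).trans hid)
  have h2 : (fun ε : ℂ => ∏ j : (Fin (Module.finrank ℂ K) ⊕ Fin (Module.finrank ℂ C)),
        Sum.elim (fun _ => ε) (fun _ => (1 : ℂ)) j) = fun ε => ε ^ r := by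
    funext ε
    simp [hr]
  rw [h2] at key
  simp only [Matrix.of_apply, Units.smul_def, zsmul_eq_mul]
  exact key.const_mul_left _
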